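/- On the smooth affine cubic surface C = {R = 0}, any two algebraic symplectic (i.e., regular nowhere-degenerate closed) 2-forms are proportional; in particular every algebraic symplectic form is a nonzero scalar multiple of Ω = dX_1 ∧ dX_2 / (∂R/∂X_3). -/

import Mathlib

open MvPolynomial

/-- A regular 2-form on the surface `{R = 0} ⊂ ℂ³` can be written as
`ω_v = ι_v (dX₁∧dX₂∧dX₃)` for a polynomial vector field `v`; its value on the tangent
plane at a point `x` of the surface is measured by the pairing `⟨v(x), ∇R(x)⟩`, and
`ω_v` is nondegenerate (symplectic) precisely when this pairing is nonvanishing on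
the surface.  The distinguished form `Ω = dX₁∧dX₂ / (∂R/∂X₃)` satisfies `⟨v_Ω, ∇R⟩ ≡ 1`. -/
noncomputable def formPairing (R : MvPolynomial (Fin 3) ℂ) (v : Fin 3 → MvPolynomial (Fin 3) ℂ)
    (x : Fin 3 → ℂ) : ℂ :=
  ∑ i : Fin 3, eval x (v i) * eval x (pderiv i R)

/-- Weak Nullstellensatz in the form used below. -/
lemma aux_span_top (S : Set (MvPolynomial (Fin 3) ℂ))
    (h : ∀ x : Fin 3 → ℂ, ∃ f ∈ S, eval x f ≠ 0) : Ideal.span S = ⊤ := by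
  have h1 : zeroLocus ℂ (Ideal.span S) = ∅ := by
    rw [Set.eq_empty_iff_forall_notMem]
    intro x hx
    obtain ⟨f, hf, hne⟩ := h x
    have := (mem_zeroLocus_iff.1 hx) f (Ideal.subset_span hf)
    rw [aeval_eq_eval] at this
    exact hne this
  have h2 := vanishingIdeal_zeroLocus_eq_radical (K := ℂ) (Ideal.span S)
  rw [h1, vanishingIdeal_empty] at h2
  exact Ideal.radical_eq_top.1 h2.symm

/-- `Y² - 4` is not a square up to squares in `ℂ[Y]`. -/
lemma aux_nonsquare (t s : Polynomial ℂ) (hs : s ≠ 0)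
    (h : t ^ 2 = (Polynomial.X ^ 2 - Polynomial.C 4) * s ^ 2) : False := by
  have hfac : (Polynomial.X ^ 2 - Polynomial.C 4 : Polynomial ℂ)
      = (Polynomial.X - Polynomial.C 2) * (Polynomial.X - Polynomial.C (-2)) := by
    have : (Polynomial.C 4 : Polynomial ℂ) = Polynomial.C 2 * Polynomial.C 2 := by
      rw [← Polynomial.C_mul]; norm_num
    rw [this, Polynomial.C_neg]; ring
  have h1 : (Polynomial.X - Polynomial.C 2 : Polynomial ℂ) ≠ 0 := Polynomial.X_sub_C_ne_zero _
  have h2 : (Polynomial.X - Polynomial.C (-2) : Polynomial ℂ) ≠ 0 := Polynomial.X_sub_C_ne_zero _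
  have hss : s ^ 2 ≠ 0 := pow_ne_zero _ hs
  have ht : t ≠ 0 := by
    rintro rfl
    rw [hfac] at h
    exact mul_ne_zero (mul_ne_zero h1 h2) hss (by rw [← h]; ring)
  have hm := congrArg (Polynomial.rootMultiplicity 2) h
  rw [hfac, Polynomial.rootMultiplicity_mul (mul_ne_zero (mul_ne_zero h1 h2) hss),
    Polynomial.rootMultiplicity_mul (mul_ne_zero h1 h2), pow_two, pow_two,
    Polynomial.rootMultiplicity_mul (mul_ne_zero ht ht),
    Polynomial.rootMultiplicity_mul (mul_ne_zero hs hs),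
    Polynomial.rootMultiplicity_X_sub_C_self,
    Polynomial.rootMultiplicity_eq_zero (p := Polynomial.X - Polynomial.C (-2))
      (by simp)] at hm
  omega

/-- The Pell equation has only trivial solutions. -/
lemma aux_pell (β γ κ : Polynomial ℂ) (T S : Polynomial (Polynomial ℂ))
    (h : T ^ 2 = (Polynomial.C (Polynomial.X ^ 2 - Polynomial.C 4) * Polynomial.X ^ 2
      + Polynomial.C β * Polynomial.X + Polynomial.C γ) * S ^ 2 + Polynomial.C κ) : S = 0 := by
  by_contra hS
  have hα : (Polynomial.X ^ 2 - Polynomial.C 4 : Polynomial ℂ) ≠ 0 :=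
    Polynomial.X_pow_sub_C_ne_zero (by norm_num) _
  set D := Polynomial.C (Polynomial.X ^ 2 - Polynomial.C 4 : Polynomial ℂ) * Polynomial.X ^ 2
      + Polynomial.C β * Polynomial.X + Polynomial.C γ with hD
  have hdeg : D.degree = 2 := Polynomial.degree_quadratic hα
  have hlead : D.leadingCoeff = Polynomial.X ^ 2 - Polynomial.C 4 :=
    Polynomial.leadingCoeff_quadratic hα
  have hlt : (Polynomial.C κ).degree < (D * S ^ 2).degree := by
    refine lt_of_le_of_lt Polynomial.degree_C_le ?_
    rw [Polynomial.degree_mul, hdeg, Polynomial.degree_eq_natDegree (pow_ne_zero 2 hS)]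
    norm_cast
    omega
  have hl := congrArg Polynomial.leadingCoeff h
  rw [Polynomial.leadingCoeff_add_of_degree_lt' hlt, Polynomial.leadingCoeff_mul, hlead,
    Polynomial.leadingCoeff_pow, Polynomial.leadingCoeff_pow] at hl
  exact aux_nonsquare _ _ (Polynomial.leadingCoeff_ne_zero.2 hS) hl

/-- Units in the quadratic algebra `ℂ[Y][X][Z]/(R)` are constants. -/
lemma aux_unit (p₀ p₁ p₂ p₃ : ℂ) (a b : Polynomial (Polynomial ℂ))
    (hb : b = Polynomial.X * Polynomial.C Polynomial.X + Polynomial.C (Polynomial.C p₃))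
    (ha : a = - Polynomial.X ^ 2 - Polynomial.C Polynomial.X ^ 2
      + Polynomial.C (Polynomial.C p₁) * Polynomial.X
      + Polynomial.C (Polynomial.C p₂) * Polynomial.C Polynomial.X
      + Polynomial.C (Polynomial.C p₀) + 4)
    (z : QuadraticAlgebra (Polynomial (Polynomial ℂ)) a b) (hz : IsUnit z) :
    ∃ c : ℂ, c ≠ 0 ∧ z.im = 0 ∧ z.re = Polynomial.C (Polynomial.C c) := by
  have hn : IsUnit z.norm := hz.map QuadraticAlgebra.norm
  obtain ⟨k, hk, hkn⟩ := Polynomial.isUnit_iff.1 hn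
  have him : z.im = 0 := by
    apply aux_pell (2 * Polynomial.C p₃ * Polynomial.X + 4 * Polynomial.C p₁)
      (Polynomial.C p₃ ^ 2 - 4 * Polynomial.X ^ 2 + 4 * Polynomial.C p₂ * Polynomial.X
        + 4 * Polynomial.C p₀ + 16) (4 * k) (2 * z.re + b * z.im) z.im
    rw [Polynomial.C_mul, hkn, QuadraticAlgebra.norm_def]
    generalize z.re = P
    generalize z.im = Q
    rw [hb, ha]
    have e4 : (Polynomial.C (Polynomial.C 4) : Polynomial (Polynomial ℂ)) = 4 := rfl
    have e4' : (Polynomial.C 4 : Polynomial (Polynomial ℂ)) = 4 := rfl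
    have e2 : (Polynomial.C 2 : Polynomial (Polynomial ℂ)) = 2 := rfl
    have e16 : (Polynomial.C 16 : Polynomial (Polynomial ℂ)) = 16 := rfl
    simp only [Polynomial.C_add, Polynomial.C_sub, Polynomial.C_mul, Polynomial.C_pow, e4, e4', e2,
      e16]
    ring
  rw [QuadraticAlgebra.norm_def, him] at hn
  have hre : IsUnit z.re := by
    apply isUnit_of_mul_isUnit_left (y := z.re)
    simpa using hn
  obtain ⟨q, hq, hqe⟩ := Polynomial.isUnit_iff.1 hre
  obtain ⟨c, hc, hce⟩ := Polynomial.isUnit_iff.1 hq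
  exact ⟨c, hc.ne_zero, him, by rw [← hqe, ← hce]⟩

/-- A polynomial which does not vanish on the surface is constant there. -/
lemma aux_const (p₀ p₁ p₂ p₃ : ℂ)
    (R : MvPolynomial (Fin 3) ℂ)
    (hRdef : R = X 0 * X 1 * X 2 - X 0 ^ 2 - X 1 ^ 2 - X 2 ^ 2
      + C p₁ * X 0 + C p₂ * X 1 + C p₃ * X 2 + C p₀ + 4)
    (f : MvPolynomial (Fin 3) ℂ) (hf : ∀ x : Fin 3 → ℂ, eval x R = 0 → eval x f ≠ 0) :
    ∃ c : ℂ, c ≠ 0 ∧ ∀ x : Fin 3 → ℂ, eval x R = 0 → eval x f = c := by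
  have hspan : Ideal.span ({f, R} : Set (MvPolynomial (Fin 3) ℂ)) = ⊤ := by
    apply aux_span_top
    intro x
    by_cases hx : eval x R = 0
    · exact ⟨f, by simp, hf x hx⟩
    · exact ⟨R, by simp, hx⟩
  have h1 : (1 : MvPolynomial (Fin 3) ℂ) ∈ Ideal.span ({f, R} : Set (MvPolynomial (Fin 3) ℂ)) := by
    rw [hspan]; trivial
  obtain ⟨g, r, hgr⟩ := Ideal.mem_span_pair.1 h1
  obtain ⟨b, hb⟩ : ∃ b : Polynomial (Polynomial ℂ),
    b = Polynomial.X * Polynomial.C Polynomial.X + Polynomial.C (Polynomial.C p₃) := ⟨_, rfl⟩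
  obtain ⟨a, ha⟩ : ∃ a : Polynomial (Polynomial ℂ),
    a = - Polynomial.X ^ 2 - Polynomial.C Polynomial.X ^ 2
      + Polynomial.C (Polynomial.C p₁) * Polynomial.X
      + Polynomial.C (Polynomial.C p₂) * Polynomial.C Polynomial.X
      + Polynomial.C (Polynomial.C p₀) + 4 := ⟨_, rfl⟩
  let ι : Polynomial (Polynomial ℂ) →+* QuadraticAlgebra (Polynomial (Polynomial ℂ)) a b :=
    algebraMap _ _
  let om : QuadraticAlgebra (Polynomial (Polynomial ℂ)) a b := ⟨0, 1⟩
  have hom : om * om = ι a + ι b * om := by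
    ext <;> simp [om, ι]
  let φ : MvPolynomial (Fin 3) ℂ →+* QuadraticAlgebra (Polynomial (Polynomial ℂ)) a b :=
    eval₂Hom (ι.comp (Polynomial.C.comp Polynomial.C))
      ![ι Polynomial.X, ι (Polynomial.C Polynomial.X), om]
  have φC (c : ℂ) : φ (C c) = ι (Polynomial.C (Polynomial.C c)) := by simp [φ]
  have φ0 : φ (X 0) = ι Polynomial.X := by simp [φ]
  have φ1 : φ (X 1) = ι (Polynomial.C Polynomial.X) := by simp [φ]
  have φ2 : φ (X 2) = om := by simp [φ]
  have φR : φ R = 0 := by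
    rw [hRdef]
    simp only [map_add, map_sub, map_mul, map_pow, φC, φ0, φ1, φ2, map_ofNat]
    have ha' := congrArg ι ha
    have hb' := congrArg ι hb
    simp only [map_add, map_sub, map_mul, map_pow, map_neg, map_ofNat] at ha' hb'
    linear_combination -hom - ha' - om * hb'
  have hunit : IsUnit (φ f) := by
    refine IsUnit.of_mul_eq_one (φ g) ?_
    have := congrArg φ hgr
    rw [map_add, map_mul, map_mul, φR, map_one, mul_zero, add_zero, mul_comm] at this
    exact this
  obtain ⟨c, hc, him, hre⟩ := aux_unit p₀ p₁ p₂ p₃ a b hb ha _ hunit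
  refine ⟨c, hc, fun x hx => ?_⟩
  let e : Polynomial (Polynomial ℂ) →+* ℂ :=
    Polynomial.eval₂RingHom (Polynomial.evalRingHom (x 1)) (x 0)
  have hrel : x 2 * x 2 = e a + e b * x 2 := by
    rw [ha, hb]
    rw [hRdef] at hx
    simp only [map_add, map_sub, map_mul, map_pow, eval_X, eval_C, map_ofNat] at hx
    simp only [map_add, map_sub, map_mul, map_pow, map_neg, map_ofNat]
    simp only [e, Polynomial.coe_eval₂RingHom, Polynomial.eval₂_X, Polynomial.eval₂_C,
      Polynomial.coe_evalRingHom, Polynomial.eval_X, Polynomial.eval_C]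
    linear_combination -hx
  let ψ : QuadraticAlgebra (Polynomial (Polynomial ℂ)) a b →+* ℂ :=
    { toFun := fun z => e z.re + e z.im * x 2
      map_one' := by
        change e 1 + e 0 * x 2 = 1
        simp
      map_zero' := by simp
      map_add' := fun z w => by simp; ring
      map_mul' := fun z w => by
        simp only [QuadraticAlgebra.re_mul, QuadraticAlgebra.im_mul, map_add, map_mul]
        linear_combination (-(e z.im * e w.im)) * hrel }
  have hψ (z : QuadraticAlgebra (Polynomial (Polynomial ℂ)) a b) :
    ψ z = e z.re + e z.im * x 2 := rfl
  have hcomp : ψ.comp φ = eval x := by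
    apply MvPolynomial.ringHom_ext
    · intro r
      rw [RingHom.comp_apply, φC, hψ]
      simp [ι, e]
    · intro i
      rw [RingHom.comp_apply]
      fin_cases i
      · change ψ (φ (X 0)) = eval x (X 0)
        rw [φ0, hψ]; simp [ι, e]
      · change ψ (φ (X 1)) = eval x (X 1)
        rw [φ1, hψ]; simp [ι, e]
      · change ψ (φ (X 2)) = eval x (X 2)
        rw [φ2, hψ]; simp [om]
  rw [← hcomp, RingHom.comp_apply, hψ, him, hre]
  simp [e]

/-- On the smooth affine cubic surface `C = {R = 0}`, any two algebraic
symplectic (regular nowhere-degenerate) 2-forms are proportional; in particular, since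
`Ω = dX₁∧dX₂/(∂R/∂X₃)` is such a form (represented by a polynomial vector field `vΩ`
with `⟨vΩ, ∇R⟩ ≡ 1` on `C`), every algebraic symplectic form on `C` is a nonzero scalar
multiple of `Ω`. -/
theorem symplectic_forms_proportional (p₀ p₁ p₂ p₃ : ℂ)
    (R : MvPolynomial (Fin 3) ℂ)
    (hRdef : R = X 0 * X 1 * X 2 - X 0 ^ 2 - X 1 ^ 2 - X 2 ^ 2
      + C p₁ * X 0 + C p₂ * X 1 + C p₃ * X 2 + C p₀ + 4)
    (hsmooth : ∀ x : Fin 3 → ℂ, eval x R = 0 → ∃ i, eval x (pderiv i R) ≠ 0) :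
    -- `Ω` is realized by a polynomial vector field `vΩ` with `⟨vΩ, ∇R⟩ ≡ 1` on `C`
    (∃ vΩ : Fin 3 → MvPolynomial (Fin 3) ℂ,
      ∀ x : Fin 3 → ℂ, eval x R = 0 → formPairing R vΩ x = 1) ∧
    -- any two symplectic forms are proportional
    (∀ v w : Fin 3 → MvPolynomial (Fin 3) ℂ,
      (∀ x : Fin 3 → ℂ, eval x R = 0 → formPairing R v x ≠ 0) →
      (∀ x : Fin 3 → ℂ, eval x R = 0 → formPairing R w x ≠ 0) →
      ∃ c : ℂ, c ≠ 0 ∧ ∀ x : Fin 3 → ℂ, eval x R = 0 →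
        formPairing R w x = c * formPairing R v x) ∧
    -- in particular every symplectic form is a nonzero scalar multiple of `Ω`
    (∀ v : Fin 3 → MvPolynomial (Fin 3) ℂ,
      (∀ x : Fin 3 → ℂ, eval x R = 0 → formPairing R v x ≠ 0) →
      ∃ c : ℂ, c ≠ 0 ∧ ∀ x : Fin 3 → ℂ, eval x R = 0 → formPairing R v x = c) := by
  have key : ∀ v : Fin 3 → MvPolynomial (Fin 3) ℂ,
      (∀ x : Fin 3 → ℂ, eval x R = 0 → formPairing R v x ≠ 0) →
      ∃ c : ℂ, c ≠ 0 ∧ ∀ x : Fin 3 → ℂ, eval x R = 0 → formPairing R v x = c := by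
    intro v hv
    have hp (x : Fin 3 → ℂ) : formPairing R v x = eval x (∑ i, v i * pderiv i R) := by
      simp [formPairing]
    simp only [hp] at hv ⊢
    exact aux_const p₀ p₁ p₂ p₃ R hRdef _ hv
  refine ⟨?_, ?_, key⟩
  · have hspan : Ideal.span (insert R (Set.range fun i => pderiv i R)) = ⊤ := by
      apply aux_span_top
      intro x
      by_cases hx : eval x R = 0
      · obtain ⟨i, hi⟩ := hsmooth x hx
        exact ⟨_, Set.mem_insert_of_mem _ ⟨i, rfl⟩, hi⟩
      · exact ⟨R, by simp, hx⟩
    have h1 : (1 : MvPolynomial (Fin 3) ℂ) ∈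
        Ideal.span (insert R (Set.range fun i => pderiv i R)) := by
      rw [hspan]; trivial
    obtain ⟨r, y, hy, hry⟩ := Ideal.mem_span_insert.1 h1
    obtain ⟨v, hv⟩ := Ideal.mem_span_range_iff_exists_fun.1 hy
    refine ⟨v, fun x hx => ?_⟩
    have := congrArg (eval x) hry
    rw [← hv] at this
    simp only [map_one, map_add, map_mul, hx, mul_zero, zero_add, map_sum] at this
    exact this.symm
  · intro v w hv hw
    obtain ⟨c, hc, hvc⟩ := key v hv
    obtain ⟨d, hd, hwd⟩ := key w hw
    refine ⟨d / c, div_ne_zero hd hc, fun x hx => ?_⟩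
    rw [hvc x hx, hwd x hx]
    field_simp
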